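/- Let n ≥ 3, let R = {±e_i ± e_j : 1 ≤ i < j ≤ n} ∪ {±2e_i : 1 ≤ i ≤ n} ⊂ ℝⁿ (a root system of type C_n, with e_1,…,e_n the standard basis) and β = −2e_1 (a long root). Then q(β) = 2, i.e. there is an admissible sequence of length 2 for β but none of length 3. -/

import Mathlib

/-- `α` is an admissible sequence for `β`: each `αᵢ ∈ R`, `αᵢ + αⱼ ∉ R ∪ {0}` for
`i ≠ j`, and `β` plus any nonempty subset-sum of the `αᵢ` lies in `R`. -/
def IsAdmissible {V : Type*} [AddCommGroup V] (R : Set V) (β : V) {k : ℕ}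
    (α : Fin k → V) : Prop :=
  (∀ i, α i ∈ R) ∧
    (∀ i j : Fin k, i ≠ j → α i + α j ∉ R ∧ α i + α j ≠ 0) ∧
    ∀ s : Finset (Fin k), s.Nonempty → β + ∑ i ∈ s, α i ∈ R

/-- The standard basis vector `eᵢ` of `ℝⁿ`. -/
noncomputable def e (n : ℕ) (i : Fin n) : EuclideanSpace ℝ (Fin n) :=
  EuclideanSpace.single i 1

/-- The root system of type `C_n`:
`{±eᵢ ± eⱼ : 1 ≤ i < j ≤ n} ∪ {±2eᵢ : 1 ≤ i ≤ n}`. -/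
def RootC (n : ℕ) : Set (EuclideanSpace ℝ (Fin n)) :=
  {v | (∃ i : Fin n, v = (2 : ℝ) • e n i ∨ v = -((2 : ℝ) • e n i)) ∨
    ∃ i j : Fin n, i ≠ j ∧
      (v = e n i + e n j ∨ v = -(e n i + e n j) ∨ v = e n i - e n j)}

theorem e_apply (n : ℕ) (i j : Fin n) : e n i j = if j = i then 1 else 0 := by
  simp [e, PiLp.single_apply]

theorem zero_notMem_rootC (n : ℕ) : (0 : EuclideanSpace ℝ (Fin n)) ∉ RootC n := by
  rintro (⟨i, h | h⟩ | ⟨i, j, hij, h | h | h⟩) <;> have := congrArg (fun v => v i) h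
  · simp [e_apply] at this
  · simp [e_apply] at this
  all_goals simp [e_apply, hij] at this

/-- Coordinates of a root are integers of absolute value at most `2`, and the extreme values
are attained only by the long roots. -/
theorem RootC.coord_cases {n : ℕ} {v : EuclideanSpace ℝ (Fin n)} (hv : v ∈ RootC n) (k : Fin n) :
    v = (2 : ℝ) • e n k ∨ v = -((2 : ℝ) • e n k) ∨ v k = -1 ∨ v k = 0 ∨ v k = 1 := by
  rcases hv with ⟨i, h | h⟩ | ⟨i, j, hij, h | h | h⟩
  · by_cases hki : k = i <;> simp [h, hki, e_apply]
  · by_cases hki : k = i <;> simp [h, hki, e_apply]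
  all_goals
    by_cases hki : k = i <;> by_cases hkj : k = j <;> simp_all [e_apply]

theorem RootC.eq_of_coord_eq_one {n : ℕ} {v : EuclideanSpace ℝ (Fin n)} (hv : v ∈ RootC n)
    {k : Fin n} (hk : v k = 1) :
    ∃ j, j ≠ k ∧ ∃ s : ℝ, (s = 1 ∨ s = -1) ∧ v = e n k + s • e n j := by
  rcases hv with ⟨i, h | h⟩ | ⟨i, j, hij, h | h | h⟩
  · by_cases hki : k = i <;> simp [h, hki, e_apply] at hk
  · by_cases hki : k = i <;> norm_num [h, hki, e_apply] at hk
  · by_cases hki : k = i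
    · subst hki
      exact ⟨j, hij.symm, 1, by simp, by simp [h]⟩
    · by_cases hkj : k = j
      · subst hkj
        exact ⟨i, hij, 1, by simp, by simp [h, add_comm]⟩
      · simp [h, hki, hkj, e_apply] at hk
  · by_cases hki : k = i <;> by_cases hkj : k = j <;> norm_num [h, hki, hkj, e_apply] at hk
    all_goals split_ifs at hk <;> norm_num at hk
  · by_cases hki : k = i
    · subst hki
      exact ⟨j, hij.symm, -1, by simp, by simp [h, sub_eq_add_neg]⟩
    · by_cases hkj : k = j <;> norm_num [h, hki, hkj, e_apply] at hk
      all_goals split_ifs at hk <;> norm_num at hk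

/-- If `v` and `v - 2eₖ` are both roots, then `v` is a short root with `k`-th coordinate `1`. -/
theorem RootC.coord_eq_one {n : ℕ} {v : EuclideanSpace ℝ (Fin n)} {k : Fin n}
    (hv : v ∈ RootC n) (hw : -((2 : ℝ) • e n k) + v ∈ RootC n) : v k = 1 := by
  have hv0 : v ≠ 0 := fun h => zero_notMem_rootC n (h ▸ hv)
  have hw0 : -((2 : ℝ) • e n k) + v ≠ 0 := fun h => zero_notMem_rootC n (h ▸ hw)
  have hwk : (-((2 : ℝ) • e n k) + v) k = v k - 2 := by simp [e_apply]; ring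
  rcases RootC.coord_cases hv k with h | h | h | h | h
  · exact absurd (by rw [h]; simp) hw0
  all_goals try exact h
  all_goals
    rcases RootC.coord_cases hw k with h' | h' | h' | h' | h'
    · have := congrArg (fun u => u k) h'
      simp [h, e_apply] at this
      try norm_num at this
    · exact absurd (by simpa using h') hv0
    all_goals
      rw [hwk, h] at h'
      norm_num [e_apply] at h'

theorem not_isAdmissible_three {n : ℕ} (k : Fin n) (α : Fin 3 → EuclideanSpace ℝ (Fin n)) :
    ¬ IsAdmissible (RootC n) (-((2 : ℝ) • e n k)) α := by
  rintro ⟨hR, hpair, hsum⟩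
  have hα : ∀ i, ∃ j, j ≠ k ∧ ∃ s : ℝ, (s = 1 ∨ s = -1) ∧ α i = e n k + s • e n j := fun i =>
    RootC.eq_of_coord_eq_one (hR i)
      (RootC.coord_eq_one (hR i) (by simpa using hsum {i} (by simp)))
  choose a hak s hs hα using hα
  have hsame : ∀ i j, i ≠ j → a i = a j → s i = s j := by
    intro i j hij haij
    by_contra hne
    have hneg : s j = -s i := by
      rcases hs i with h | h <;> rcases hs j with h' | h' <;> simp_all
    refine (hpair i j hij).1 (Or.inl ⟨k, Or.inl ?_⟩)
    rw [hα, hα, haij, hneg, two_smul]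
    module
  have htot := hsum Finset.univ (by simp)
  rw [Fin.sum_univ_three, hα, hα, hα] at htot
  obtain ⟨d, -, t, ht, h⟩ := RootC.eq_of_coord_eq_one (k := k) htot (by
    simp [e_apply, (hak _).symm]; norm_num)
  have heq : ∀ x, s 0 * (if x = a 0 then 1 else 0) + s 1 * (if x = a 1 then 1 else 0)
      + s 2 * (if x = a 2 then 1 else 0) = t * (if x = d then 1 else 0) := by
    intro x
    have := congrArg (fun u => u x) h
    simp only [PiLp.add_apply, PiLp.neg_apply, PiLp.smul_apply, smul_eq_mul, e_apply] at this
    linarith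
  have h01 := hsame 0 1 (by decide)
  have h02 := hsame 0 2 (by decide)
  have h12 := hsame 1 2 (by decide)
  have q0 := heq (a 0)
  have q1 := heq (a 1)
  have q2 := heq (a 2)
  have hs0 := hs 0
  have hs1 := hs 1
  have hs2 := hs 2
  clear heq hsame hs h htot hα hsum hpair hR hak
  grind

theorem isAdmissible_two {n : ℕ} {k j : Fin n} (hjk : j ≠ k) :
    IsAdmissible (RootC n) (-((2 : ℝ) • e n k)) (fun _ : Fin 2 => e n k + e n j) := by
  refine ⟨fun _ => Or.inr ⟨k, j, hjk.symm, Or.inl rfl⟩, fun _ _ _ => ⟨fun h => ?_, fun h => ?_⟩,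
    fun s hs => ?_⟩
  · rcases RootC.coord_cases h k with h' | h' | h' | h' | h'
    · have := congrArg (fun u => u j) h'
      norm_num [e_apply, hjk] at this
    · have := congrArg (fun u => u j) h'
      norm_num [e_apply, hjk] at this
    all_goals norm_num [e_apply, hjk.symm] at h'
  · have := congrArg (fun u => u k) h
    norm_num [e_apply, hjk.symm] at this
  · have hcard : s.card = 1 ∨ s.card = 2 := by
      have := hs.card_pos
      have := s.card_le_univ
      simp only [Fintype.card_fin] at this
      omega
    rw [Finset.sum_const]
    rcases hcard with h | h <;> rw [h]
    · exact Or.inr ⟨j, k, hjk, Or.inr (Or.inr (by module))⟩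
    · exact Or.inl ⟨j, Or.inl (by module)⟩

/-- For `n ≥ 3`, in the root system of type `C_n` the long root `β = −2e₁` has
`q(β) = 2`: there is an admissible sequence of length `2` for `β` but none of
length `3`. -/
theorem cN_q_eq_two (n : ℕ) (hn : 3 ≤ n) :
    (∃ α : Fin 2 → EuclideanSpace ℝ (Fin n),
        IsAdmissible (RootC n) (-((2 : ℝ) • e n ⟨0, by omega⟩)) α) ∧
      ¬ ∃ α : Fin 3 → EuclideanSpace ℝ (Fin n),
        IsAdmissible (RootC n) (-((2 : ℝ) • e n ⟨0, by omega⟩)) α := by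
  refine ⟨⟨_, isAdmissible_two (j := ⟨1, by omega⟩) (by simp)⟩, ?_⟩
  rintro ⟨α, hα⟩
  exact not_isAdmissible_three _ α hα
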